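/- arXiv:2604.14079 — 2 statements merged into one kernel-verified Lean document; each statement's English description precedes it below -/
import Mathlib

section
/- Let K and S be real N×N matrices with K symmetric, let h^d > 0 be a positive real number, and set K_S := Sᵀ K S and K̃_S := K_S + h^d Sᵀ S. Assume there exist constants c₀, C₀ > 0 such that c₀‖z‖² ≤ zᵀ K_S z ≤ C₀‖z‖² for all z ∈ ℝ^N, and a constant C_P > 0 such that the discrete Poincaré inequality h^d ‖v‖² ≤ C_P vᵀ K v holds for all v ∈ ℝ^N. Then for every z ∈ ℝ^N, c₀‖z‖² ≤ zᵀ K̃_S z ≤ (1 + C_P) C₀ ‖z‖². -/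
open Matrix

/-- A congruence `Sᵀ * A * S` moves onto the vectors of the bilinear form of `A`. -/
theorem dotProduct_mulVec_congruence {m n R : Type*} [Fintype m] [Fintype n] [CommSemiring R]
    (A : Matrix m m R) (S : Matrix m n R) (x y : n → R) :
    x ⬝ᵥ (Sᵀ * A * S) *ᵥ y = (S *ᵥ x) ⬝ᵥ A *ᵥ (S *ᵥ y) := by
  rw [← mulVec_mulVec, ← mulVec_mulVec, dotProduct_mulVec, vecMul_transpose]

/-- **Uniform spectral bounds for the shifted BPX-preconditioned operator.**
If `K_S := Sᵀ K S` satisfies `c₀‖z‖² ≤ zᵀ K_S z ≤ C₀‖z‖²` and the discrete Poincaré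
inequality `h^d ‖v‖² ≤ C_P vᵀ K v` holds, then the shifted preconditioned matrix
`K̃_S := K_S + h^d Sᵀ S` satisfies `c₀‖z‖² ≤ zᵀ K̃_S z ≤ (1 + C_P) C₀ ‖z‖²`. -/
theorem shifted_bpx_spectral_bounds
    (N : ℕ) (K S : Matrix (Fin N) (Fin N) ℝ) (hK : K.IsSymm)
    (hd : ℝ) (hhd : 0 < hd)
    (KS KtS : Matrix (Fin N) (Fin N) ℝ)
    (hKS : KS = Sᵀ * K * S)
    (hKtS : KtS = KS + hd • (Sᵀ * S))
    (c₀ C₀ C_P : ℝ) (hc₀ : 0 < c₀) (hC₀ : 0 < C₀) (hCP : 0 < C_P)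
    (hlow : ∀ z : EuclideanSpace ℝ (Fin N), c₀ * ‖z‖ ^ 2 ≤ z ⬝ᵥ KS.mulVec z)
    (hhigh : ∀ z : EuclideanSpace ℝ (Fin N), z ⬝ᵥ KS.mulVec z ≤ C₀ * ‖z‖ ^ 2)
    (hPoincare : ∀ v : EuclideanSpace ℝ (Fin N),
      hd * ‖v‖ ^ 2 ≤ C_P * (v ⬝ᵥ K.mulVec v)) :
    ∀ z : EuclideanSpace ℝ (Fin N),
      c₀ * ‖z‖ ^ 2 ≤ z ⬝ᵥ KtS.mulVec z ∧
        z ⬝ᵥ KtS.mulVec z ≤ (1 + C_P) * C₀ * ‖z‖ ^ 2 := by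
  intro z
  set v : EuclideanSpace ℝ (Fin N) := WithLp.toLp 2 (S *ᵥ z)
  have hsplit : z ⬝ᵥ KtS.mulVec z = z ⬝ᵥ KS.mulVec z + hd * ‖v‖ ^ 2 := by
    rw [hKtS, add_mulVec, dotProduct_add, smul_mulVec, dotProduct_smul, smul_eq_mul,
      ← mulVec_mulVec, dotProduct_mulVec _ Sᵀ, vecMul_transpose, EuclideanSpace.real_norm_sq_eq]
    simp [v, dotProduct, sq]
  have hcongr : v ⬝ᵥ K.mulVec v = z ⬝ᵥ KS.mulVec z := by
    rw [hKS, dotProduct_mulVec_congruence]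
  have hshift := hPoincare v
  rw [hcongr] at hshift
  rw [hsplit]
  constructor
  · linarith [hlow z, mul_nonneg hhd.le (sq_nonneg ‖v‖)]
  · linarith [hhigh z, mul_le_mul_of_nonneg_left (hhigh z) hCP.le]
end

section
/- Let K and S be real N×N matrices with K symmetric, let h^d > 0 be a positive real number, and set K_S := Sᵀ K S and K̃_S := K_S + h^d Sᵀ S. Assume there exist constants c₀, C₀ > 0 such that c₀‖z‖² ≤ zᵀ K_S z ≤ C₀‖z‖² for all z ∈ ℝ^N, and a constant C_P > 0 such that h^d ‖v‖² ≤ C_P vᵀ K v holds for all v ∈ ℝ^N. Then K̃_S is symmetric and every eigenvalue μ of K̃_S satisfies c₀ ≤ μ ≤ (1 + C_P) C₀. -/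
open Matrix

/-- The Euclidean norm squared of a coordinate vector is its dot product with itself. -/
lemma norm_toLp_sq_eq_dotProduct {n : Type*} [Fintype n] (v : n → ℝ) :
    ‖WithLp.toLp 2 v‖ ^ 2 = v ⬝ᵥ v := by
  rw [EuclideanSpace.real_norm_sq_eq]
  simp [dotProduct, pow_two]

/-- A congruence transform moves onto the vectors of the quadratic form. -/
lemma dotProduct_transpose_mul_mul_mulVec {m n R : Type*} [Fintype m] [Fintype n]
    [CommSemiring R] (K : Matrix m m R) (S : Matrix m n R) (v : n → R) :
    v ⬝ᵥ (Sᵀ * K * S) *ᵥ v = (S *ᵥ v) ⬝ᵥ K *ᵥ (S *ᵥ v) := by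
  rw [← mulVec_mulVec, ← mulVec_mulVec, dotProduct_mulVec, vecMul_transpose]

/-- **The shifted BPX-preconditioned operator is symmetric with mesh-uniform eigenvalue
bounds.** Under the spectral bounds for `K_S := Sᵀ K S` and the discrete Poincaré
inequality for `K`, the matrix `K̃_S := K_S + h^d Sᵀ S` is symmetric and every real
eigenvalue `μ` of `K̃_S` satisfies `c₀ ≤ μ ≤ (1 + C_P) C₀`. -/
theorem shifted_bpx_symm_eigenvalue_bounds
    (N : ℕ) (K S : Matrix (Fin N) (Fin N) ℝ) (hK : K.IsSymm)
    (hd : ℝ) (hhd : 0 < hd)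
    (KS KtS : Matrix (Fin N) (Fin N) ℝ)
    (hKS : KS = Sᵀ * K * S)
    (hKtS : KtS = KS + hd • (Sᵀ * S))
    (c₀ C₀ C_P : ℝ) (hc₀ : 0 < c₀) (hC₀ : 0 < C₀) (hCP : 0 < C_P)
    (hlow : ∀ z : EuclideanSpace ℝ (Fin N), c₀ * ‖z‖ ^ 2 ≤ z ⬝ᵥ KS.mulVec z)
    (hhigh : ∀ z : EuclideanSpace ℝ (Fin N), z ⬝ᵥ KS.mulVec z ≤ C₀ * ‖z‖ ^ 2)
    (hPoincare : ∀ v : EuclideanSpace ℝ (Fin N),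
      hd * ‖v‖ ^ 2 ≤ C_P * (v ⬝ᵥ K.mulVec v)) :
    KtS.IsSymm ∧
      ∀ μ : ℝ, (∃ v : Fin N → ℝ, v ≠ 0 ∧ KtS.mulVec v = μ • v) →
        c₀ ≤ μ ∧ μ ≤ (1 + C_P) * C₀ := by
  subst hKtS hKS
  refine ⟨?_, ?_⟩
  · simp [IsSymm, transpose_add, transpose_mul, hK.eq, Matrix.mul_assoc]
  rintro μ ⟨v, hv, hμ⟩
  have hpos : 0 < v ⬝ᵥ v :=
    lt_of_le_of_ne (Finset.sum_nonneg fun i _ => mul_self_nonneg (v i)) fun h =>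
      hv (dotProduct_self_eq_zero.mp h.symm)
  have hl := hlow (WithLp.toLp 2 v)
  have hu := hhigh (WithLp.toLp 2 v)
  have hp := hPoincare (WithLp.toLp 2 (S *ᵥ v))
  rw [norm_toLp_sq_eq_dotProduct] at hl hu hp
  rw [dotProduct_transpose_mul_mul_mulVec] at hl hu
  have hS : 0 ≤ hd * ((S *ᵥ v) ⬝ᵥ (S *ᵥ v)) :=
    mul_nonneg hhd.le (Finset.sum_nonneg fun i _ => mul_self_nonneg _)
  have heig : (S *ᵥ v) ⬝ᵥ K *ᵥ (S *ᵥ v) + hd * ((S *ᵥ v) ⬝ᵥ (S *ᵥ v)) = μ * (v ⬝ᵥ v) := by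
    have h := congrArg (v ⬝ᵥ ·) hμ
    simp only [add_mulVec, smul_mulVec, dotProduct_add, dotProduct_smul, smul_eq_mul,
      dotProduct_transpose_mul_mul_mulVec] at h
    rwa [← mulVec_mulVec, dotProduct_mulVec v Sᵀ, vecMul_transpose] at h
  constructor
  · refine le_of_mul_le_mul_right ?_ hpos
    linarith
  · refine le_of_mul_le_mul_right ?_ hpos
    have := mul_le_mul_of_nonneg_left hu hCP.le
    linarith
end
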